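/- Let M be a strongly functional lexicographic transducer over A = W* × Σ* × D, i.e., one with exactly one final state and no reachable pair of conflicting transitions with equal weights. Then there exists a finite automaton N over Σ* × D, with state set a subset of 2^Q × Q together with one extra state, whose recognized language L(N) equals min_{D→W*} L(M)\W*. -/

import Mathlib

/-- An automaton `M = (Q, I, A, δ, F)`: `Q` a type of states, transitions
`δ ⊆ Q × A × Q` (a finite set), initial states `I` and final states `F`. -/
structure Automaton (Q A : Type) where
  trans : Set (Q × A × Q)
  trans_fin : trans.Finite
  init : Set Q
  final : Set Q

namespace Automaton

variable {Q A B C : Type}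

/-- A path from `q` to `q'`: a list of transitions of `M` with consecutive states. -/
def IsPath (M : Automaton Q A) : Q → List (Q × A × Q) → Q → Prop
  | q, [], q' => q = q'
  | q, t :: ts, q' => t ∈ M.trans ∧ t.1 = q ∧ IsPath M t.2.2 ts q'

/-- The signature of a path: product of its labels. -/
def signature [Monoid A] (p : List (Q × A × Q)) : A :=
  (p.map fun t => t.2.1).prod

/-- The language of `M`: signatures of accepting paths. -/
def lang [Monoid A] (M : Automaton Q A) : Set A :=
  {a | ∃ q ∈ M.init, ∃ q' ∈ M.final, ∃ p, M.IsPath q p q' ∧ signature p = a}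

/-- `M` is sequential: no transition label is a product of two non-identity elements. -/
def Sequential [Monoid A] (M : Automaton Q A) : Prop :=
  ∀ q a₁ a₂ q', (q, a₁ * a₂, q') ∈ M.trans → a₁ = 1 ∨ a₂ = 1

/-- Sequential up to `B`: `(q,(bb',c),q') ∈ δ` implies `b = 1` or `b' = 1`. -/
def SequentialUpTo [Monoid B] [Monoid C] (M : Automaton Q (B × C)) : Prop :=
  ∀ q b b' c q', (q, (b * b', c), q') ∈ M.trans → b = 1 ∨ b' = 1

/-- Deterministic up to `B`: sequential up to `B`, a unique initial state,
no transition with `B`-component `1`, and `δ ⊆ Q × (B \ {1}) → C × Q`. -/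
def DeterministicUpTo [Monoid B] [Monoid C] (M : Automaton Q (B × C)) : Prop :=
  M.SequentialUpTo ∧ (∃ q₀, M.init = {q₀}) ∧
  (∀ q b c q', (q, (b, c), q') ∈ M.trans → b ≠ 1) ∧
  (∀ q b c c'' q' q'', (q, (b, c), q') ∈ M.trans → (q, (b, c''), q'') ∈ M.trans →
    c = c'' ∧ q' = q'')

/-- `δ̂_C(S,x)`: pairs `(q', y·y')` such that some `(q,y) ∈ S` and some path
from `q` to `q'` has signature `(x,y')`. -/
def deltaHatC [Monoid B] [Monoid C] (M : Automaton Q (B × C)) (S : Set (Q × C)) (x : B) :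
    Set (Q × C) :=
  {r | ∃ q y y' p, (q, y) ∈ S ∧ M.IsPath q p r.1 ∧ signature p = (x, y') ∧ r.2 = y * y'}

/-- `M(b)`: the set of `c` with `(b,c)` in the language of `M`. -/
def output [Monoid B] [Monoid C] (M : Automaton Q (B × C)) (b : B) : Set C :=
  {c | (b, c) ∈ M.lang}

end Automaton

/-- A set of pairs is a partial function. -/
def IsPFun {X Y : Type} (S : Set (X × Y)) : Prop :=
  ∀ x y y', (x, y) ∈ S → (x, y') ∈ S → y = y'

/-- Right-to-left lexicographic (strict) order on strings over a totally
ordered alphabet `W`: `b₁ < b₂` iff the reversals compare lexicographically. -/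
def RtlLt {W : Type} [LinearOrder W] (b₁ b₂ : FreeMonoid W) : Prop :=
  List.Lex (· < ·) (FreeMonoid.toList b₁).reverse (FreeMonoid.toList b₂).reverse

/-- Non-strict right-to-left lexicographic order. -/
def RtlLe {W : Type} [LinearOrder W] (b₁ b₂ : FreeMonoid W) : Prop :=
  b₁ = b₂ ∨ RtlLt b₁ b₂

variable {Q W α D : Type}

/-- A lexicographic transducer: an automaton over `W* × Σ* × D` each of whose
transitions carries exactly one letter on the weight tape and one letter on
the input tape, i.e. `δ ⊆ Q × W × Σ × D × Q`. -/
def IsLexTransducer (M : Automaton Q (FreeMonoid W × FreeMonoid α × D)) : Prop :=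
  ∀ t ∈ M.trans, (FreeMonoid.toList t.2.1.1).length = 1 ∧
    (FreeMonoid.toList t.2.1.2.1).length = 1

/-- `M(c)`: pairs `(b,d)` with `(b,c,d)` in the language of `M`. -/
def lexOut [Monoid D] (M : Automaton Q (FreeMonoid W × FreeMonoid α × D))
    (c : FreeMonoid α) : Set (FreeMonoid W × D) :=
  {bd | (bd.1, c, bd.2) ∈ M.lang}

/-- The quotient `M(c)\W*`: `(d,b)` with `b` the (right-to-left lexicographic)
minimum of `{b' : (b',d) ∈ M(c)}`. -/
def lexQuot [LinearOrder W] [Monoid D] (M : Automaton Q (FreeMonoid W × FreeMonoid α × D))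
    (c : FreeMonoid α) : Set (D × FreeMonoid W) :=
  {db | (db.2, db.1) ∈ lexOut M c ∧ ∀ b', (b', db.1) ∈ lexOut M c → RtlLe db.2 b'}

/-- `min_{D→W*} L(M)\W*`: pairs `(c,d)` such that `(d,b) ∈ M(c)\W*` for some `b`
with `b ≤ b''` whenever `(d'',b'') ∈ M(c)\W*`. -/
def minRel [LinearOrder W] [Monoid D] (M : Automaton Q (FreeMonoid W × FreeMonoid α × D)) :
    Set (FreeMonoid α × D) :=
  {cd | ∃ b, (cd.2, b) ∈ lexQuot M cd.1 ∧
    ∀ d'' b'', (d'', b'') ∈ lexQuot M cd.1 → RtlLe b b''}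

/-- The input (`Σ*`) component of the signature of a path. -/
def inputSig (p : List (Q × (FreeMonoid W × FreeMonoid α × D) × Q)) : FreeMonoid α :=
  (p.map fun t => t.2.1.2.1).prod

/-- Strongly functional: exactly one accepting state, and no pair of conflicting
transitions (distinct sources, same input letter, same weight, same target)
whose source states both occur in a common superposition reachable from the
initial superposition by reading some input string. -/
def StronglyFunctional (M : Automaton Q (FreeMonoid W × FreeMonoid α × D)) : Prop :=
  (∃ qf, M.final = {qf}) ∧
  ¬ ∃ (q₁ q₂ q' : Q) (w : FreeMonoid W) (σ : FreeMonoid α) (d₁ d₂ : D),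
      q₁ ≠ q₂ ∧ (q₁, (w, σ, d₁), q') ∈ M.trans ∧ (q₂, (w, σ, d₂), q') ∈ M.trans ∧
      ∃ q₀₁ ∈ M.init, ∃ q₀₂ ∈ M.init, ∃ p₁ p₂,
        M.IsPath q₀₁ p₁ q₁ ∧ M.IsPath q₀₂ p₂ q₂ ∧ inputSig p₁ = inputSig p₂

namespace Automaton

/-- `M.Reach q a`: some path from an initial state to `q` has signature `a`. -/
inductive Reach {Q A : Type} [Monoid A] (M : Automaton Q A) : Q → A → Prop
  | init {q : Q} : q ∈ M.init → Reach M q 1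
  | step {q q' : Q} {a x : A} : Reach M q a → (q, x, q') ∈ M.trans → Reach M q' (a * x)

theorem IsPath.concat {Q A : Type} {M : Automaton Q A} {q' q'' : Q} {x : A}
    (ht : (q', x, q'') ∈ M.trans) {p : List (Q × A × Q)} {q : Q} (hp : M.IsPath q p q') :
    M.IsPath q (p ++ [(q', x, q'')]) q'' := by
  induction p generalizing q with
  | nil => exact ⟨ht, Eq.symm hp, rfl⟩
  | cons t p ih => exact ⟨hp.1, hp.2.1, ih hp.2.2⟩

theorem Reach.of_isPath {Q A : Type} [Monoid A] {M : Automaton Q A} {p : List (Q × A × Q)}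
    {q q' : Q} {a : A} (h : M.Reach q a) (hp : M.IsPath q p q') :
    M.Reach q' (a * signature p) := by
  induction p generalizing q a with
  | nil =>
    cases hp
    simpa [signature] using h
  | cons t p ih =>
    obtain ⟨ht, rfl, hp⟩ := hp
    simpa [signature, mul_assoc] using ih (h.step ht) hp

theorem reach_iff {Q A : Type} [Monoid A] {M : Automaton Q A} {q : Q} {a : A} :
    M.Reach q a ↔ ∃ q₀ ∈ M.init, ∃ p, M.IsPath q₀ p q ∧ signature p = a := by
  constructor
  · intro h
    induction h with
    | init hq => exact ⟨_, hq, [], rfl, rfl⟩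
    | step _ ht ih =>
      obtain ⟨q₀, hq₀, p, hp, rfl⟩ := ih
      exact ⟨q₀, hq₀, _, hp.concat ht, by simp [signature]⟩
  · rintro ⟨q₀, hq₀, p, hp, rfl⟩
    simpa using (Reach.init hq₀).of_isPath hp

theorem mem_lang_iff {Q A : Type} [Monoid A] {M : Automaton Q A} {a : A} :
    a ∈ M.lang ↔ ∃ q ∈ M.final, M.Reach q a := by
  simp only [reach_iff, lang, Set.mem_ofPred_eq]
  constructor
  · rintro ⟨q₀, h₀, q, hq, h⟩
    exact ⟨q, hq, q₀, h₀, h⟩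
  · rintro ⟨q, hq, q₀, h₀, h⟩
    exact ⟨q₀, h₀, q, hq, h⟩

end Automaton

section RtlOrder

variable {W : Type} [LinearOrder W]

theorem rtlLe_iff {b₁ b₂ : FreeMonoid W} :
    RtlLe b₁ b₂ ↔ (FreeMonoid.toList b₁).reverse ≤ (FreeMonoid.toList b₂).reverse := by
  rw [le_iff_eq_or_lt, List.reverse_inj, FreeMonoid.toList.apply_eq_iff_eq]
  rfl

theorem RtlLe.trans {b₁ b₂ b₃ : FreeMonoid W} (h : RtlLe b₁ b₂) (h' : RtlLe b₂ b₃) :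
    RtlLe b₁ b₃ :=
  rtlLe_iff.2 ((rtlLe_iff.1 h).trans (rtlLe_iff.1 h'))

theorem rtlLe_mul_of_iff {b₁ b₂ : FreeMonoid W} {u₁ u₂ : W} :
    RtlLe (b₁ * FreeMonoid.of u₁) (b₂ * FreeMonoid.of u₂) ↔
      u₁ < u₂ ∨ u₁ = u₂ ∧ RtlLe b₁ b₂ := by
  simp only [rtlLe_iff, FreeMonoid.toList_mul, FreeMonoid.toList_of, List.reverse_append,
    List.reverse_singleton, List.singleton_append]
  rw [le_iff_lt_or_eq, le_iff_lt_or_eq, List.cons_lt_cons_iff, List.cons.injEq]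
  tauto

theorem rtlLe_of_iff {u₁ u₂ : W} : RtlLe (FreeMonoid.of u₁) (FreeMonoid.of u₂) ↔ u₁ ≤ u₂ := by
  have h := rtlLe_mul_of_iff (b₁ := 1) (b₂ := 1) (u₁ := u₁) (u₂ := u₂)
  rw [one_mul, one_mul] at h
  rw [h, le_iff_lt_or_eq]
  simp [RtlLe]

theorem exists_rtlLe_min [Finite W] {s : Set (FreeMonoid W)} {n : ℕ}
    (hs : ∀ b ∈ s, b.length = n) (hne : s.Nonempty) : ∃ b ∈ s, ∀ b' ∈ s, RtlLe b b' := by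
  have hfin : s.Finite := (List.finite_length_eq W n).subset hs
  obtain ⟨b, hb, hmin⟩ :=
    Set.exists_min_image s (fun b => (FreeMonoid.toList b).reverse) hfin hne
  exact ⟨b, hb, fun b' hb' => rtlLe_iff.2 (hmin b' hb')⟩

end RtlOrder

theorem FreeMonoid.mul_inj_of_length_eq_one {α : Type} {c₁ c₂ x₁ x₂ : FreeMonoid α}
    (h₁ : x₁.length = 1) (h₂ : x₂.length = 1) (h : c₁ * x₁ = c₂ * x₂) : c₁ = c₂ ∧ x₁ = x₂ :=
  List.append_inj' h (h₁.trans h₂.symm)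

section LexTransducer

open Automaton

variable {Q W α D : Type} [Monoid D] {M : Automaton Q (FreeMonoid W × FreeMonoid α × D)}

theorem Automaton.Reach.exists_isPath_inputSig {q : Q} {b : FreeMonoid W} {c : FreeMonoid α}
    {d : D} (h : M.Reach q (b, c, d)) :
    ∃ q₀ ∈ M.init, ∃ p, M.IsPath q₀ p q ∧ inputSig p = c := by
  obtain ⟨q₀, h₀, p, hp, hs⟩ := reach_iff.1 h
  refine ⟨q₀, h₀, p, hp, ?_⟩
  have key : ∀ p : List (Q × (FreeMonoid W × FreeMonoid α × D) × Q),
      inputSig p = (signature p).2.1 := by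
    intro p
    induction p with
    | nil => rfl
    | cons t p ih => simp_all [inputSig, signature]
  rw [key, hs]

/-- Equal-weight transitions into a common target are never conflicting when their sources
are reachable by the same input. -/
theorem StronglyFunctional.source_unique (hsf : StronglyFunctional M) {q₁ q₂ q' : Q}
    {b₁ b₂ w : FreeMonoid W} {c σ : FreeMonoid α} {d₁ d₂ e₁ e₂ : D}
    (h₁ : M.Reach q₁ (b₁, c, d₁)) (h₂ : M.Reach q₂ (b₂, c, d₂))
    (t₁ : (q₁, (w, σ, e₁), q') ∈ M.trans) (t₂ : (q₂, (w, σ, e₂), q') ∈ M.trans) :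
    q₁ = q₂ := by
  by_contra hne
  obtain ⟨q₀₁, i₁, p₁, hp₁, s₁⟩ := h₁.exists_isPath_inputSig
  obtain ⟨q₀₂, i₂, p₂, hp₂, s₂⟩ := h₂.exists_isPath_inputSig
  exact hsf.2 ⟨q₁, q₂, q', w, σ, e₁, e₂, hne, t₁, t₂, q₀₁, i₁, q₀₂, i₂, p₁, p₂, hp₁, hp₂,
    s₁.trans s₂.symm⟩

omit [Monoid D] in
theorem IsLexTransducer.length_weight (hM : IsLexTransducer M) {q q' : Q}
    {x : FreeMonoid W × FreeMonoid α × D} (ht : (q, x, q') ∈ M.trans) : x.1.length = 1 :=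
  (hM _ ht).1

omit [Monoid D] in
theorem IsLexTransducer.length_input (hM : IsLexTransducer M) {q q' : Q}
    {x : FreeMonoid W × FreeMonoid α × D} (ht : (q, x, q') ∈ M.trans) : x.2.1.length = 1 :=
  (hM _ ht).2

omit [Monoid D] in
theorem IsLexTransducer.exists_weight (hM : IsLexTransducer M) {q q' : Q} {w : FreeMonoid W}
    {σ : FreeMonoid α} {d : D} (ht : (q, (w, σ, d), q') ∈ M.trans) :
    ∃ u, w = FreeMonoid.of u :=
  FreeMonoid.length_eq_one.1 (hM.length_weight ht)

theorem IsLexTransducer.length_eq (hM : IsLexTransducer M) {q : Q}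
    {a : FreeMonoid W × FreeMonoid α × D} (h : M.Reach q a) : a.1.length = a.2.1.length := by
  induction h with
  | init => rfl
  | step _ ht ih =>
    simp only [Prod.fst_mul, Prod.snd_mul, FreeMonoid.length_mul, ih, hM.length_weight ht,
      hM.length_input ht]

theorem IsLexTransducer.reach_one (hM : IsLexTransducer M) {q : Q} {b : FreeMonoid W} {d : D}
    (h : M.Reach q (b, 1, d)) : q ∈ M.init ∧ b = 1 := by
  refine ⟨?_, FreeMonoid.length_eq_zero.1 (hM.length_eq h)⟩
  generalize ha : (b, (1 : FreeMonoid α), d) = a at h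
  cases h with
  | init hq => exact hq
  | step _ ht =>
    have := congrArg (fun a => a.2.1.length) ha
    simp only [Prod.snd_mul, Prod.fst_mul, FreeMonoid.length_mul, FreeMonoid.length_one,
      hM.length_input ht] at this
    omega

theorem IsLexTransducer.reach_mul (hM : IsLexTransducer M) {q : Q} {b : FreeMonoid W}
    {c σ : FreeMonoid α} {d : D} (hσ : σ.length = 1) (h : M.Reach q (b, c * σ, d)) :
    ∃ q₁ b₁ w d₁ e, M.Reach q₁ (b₁, c, d₁) ∧ (q₁, (w, σ, e), q) ∈ M.trans ∧ b = b₁ * w := by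
  generalize ha : (b, c * σ, d) = a at h
  cases h with
  | init =>
    have := congrArg (fun a => a.2.1.length) ha
    simp [hσ] at this
  | @step q₁ _ a x h ht =>
    obtain ⟨b₁, c₁, d₁⟩ := a
    obtain ⟨w, σ₁, e⟩ := x
    simp only [Prod.mk_mul_mk, Prod.mk.injEq] at ha
    obtain ⟨rfl, hc, rfl⟩ := ha
    obtain ⟨rfl, rfl⟩ := FreeMonoid.mul_inj_of_length_eq_one hσ (hM.length_input ht) hc
    exact ⟨q₁, b₁, w, d₁, e, h, ht, rfl⟩

/-- `(b, d)` is the output of a run of `M` into `q` over the input `c`, of least weight. -/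
def OptimalRun [LinearOrder W] (M : Automaton Q (FreeMonoid W × FreeMonoid α × D)) (q : Q)
    (b : FreeMonoid W) (c : FreeMonoid α) (d : D) : Prop :=
  M.Reach q (b, c, d) ∧ ∀ b' d', M.Reach q (b', c, d') → RtlLe b b'

/-- A run is optimal iff its last transition has least weight among those leaving
the current superposition and the rest of the run is optimal. -/
theorem optimalRun_mul_iff [LinearOrder W] (hM : IsLexTransducer M)
    (hsf : StronglyFunctional M) {q q' : Q} {b w : FreeMonoid W} {c σ : FreeMonoid α} {d e : D}
    (h : M.Reach q (b, c, d)) (ht : (q, (w, σ, e), q') ∈ M.trans) :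
    OptimalRun M q' (b * w) (c * σ) (d * e) ↔
      OptimalRun M q b c d ∧ ∀ q₁ b₁ d₁ w₁ e₁, M.Reach q₁ (b₁, c, d₁) →
        (q₁, (w₁, σ, e₁), q') ∈ M.trans → RtlLe w w₁ := by
  obtain ⟨u, rfl⟩ := hM.exists_weight ht
  constructor
  · rintro ⟨-, hmin⟩
    refine ⟨⟨h, fun b' d' h' => ?_⟩, fun q₁ b₁ d₁ w₁ e₁ h₁ t₁ => ?_⟩
    · rcases rtlLe_mul_of_iff.1 (hmin _ _ (h'.step ht)) with hlt | ⟨-, hle⟩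
      · exact absurd hlt (lt_irrefl _)
      · exact hle
    · obtain ⟨u₁, rfl⟩ := hM.exists_weight t₁
      rw [rtlLe_of_iff]
      rcases rtlLe_mul_of_iff.1 (hmin _ _ (h₁.step t₁)) with hlt | ⟨heq, -⟩
      · exact hlt.le
      · exact heq.le
  · rintro ⟨hopt, hlast⟩
    refine ⟨h.step ht, fun b' d' h' => ?_⟩
    obtain ⟨q₁, b₁, w₁, d₁, e₁, h₁, t₁, rfl⟩ := hM.reach_mul (hM.length_input ht) h'
    have hw := hlast _ _ _ _ _ h₁ t₁
    obtain ⟨u₁, rfl⟩ := hM.exists_weight t₁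
    rw [rtlLe_of_iff] at hw
    rcases hw.lt_or_eq with hlt | rfl
    · exact rtlLe_mul_of_iff.2 (Or.inl hlt)
    · obtain rfl := hsf.source_unique h h₁ ht t₁
      exact rtlLe_mul_of_iff.2 (Or.inr ⟨rfl, hopt.2 _ _ h₁⟩)

theorem mem_minRel_iff [Finite W] [LinearOrder W] (hM : IsLexTransducer M) {qf : Q}
    (hf : M.final = {qf}) {c : FreeMonoid α} {d : D} :
    (c, d) ∈ minRel M ↔ ∃ b, OptimalRun M qf b c d := by
  have hout : ∀ b d, (b, d) ∈ lexOut M c ↔ M.Reach qf (b, c, d) := by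
    intro b d
    simp [lexOut, mem_lang_iff, hf]
  simp only [minRel, lexQuot, Set.mem_ofPred_eq, hout, OptimalRun]
  constructor
  · rintro ⟨b, ⟨hb, -⟩, hmin⟩
    refine ⟨b, hb, fun b' d' h' => ?_⟩
    obtain ⟨m, hm, hle⟩ := exists_rtlLe_min (s := {b | M.Reach qf (b, c, d')}) (n := c.length)
      (fun _ hb => hM.length_eq hb) ⟨b', h'⟩
    exact (hmin d' m ⟨hm, hle⟩).trans (hle b' h')
  · rintro ⟨b, hb, hmin⟩
    exact ⟨b, ⟨hb, fun b' h' => hmin b' d h'⟩, fun d'' b'' h => hmin b'' d'' h.1⟩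

variable [Fintype Q]

open Classical in
/-- The superposition of `M` after reading `c`. -/
noncomputable def superposition (M : Automaton Q (FreeMonoid W × FreeMonoid α × D))
    (c : FreeMonoid α) : Finset Q :=
  Finset.univ.filter fun q => ∃ b d, M.Reach q (b, c, d)

open Classical in
/-- The set of `σ`-successors of a set of states. -/
noncomputable def superpositionStep (M : Automaton Q (FreeMonoid W × FreeMonoid α × D))
    (S : Finset Q) (σ : FreeMonoid α) : Finset Q :=
  Finset.univ.filter fun q' => ∃ q ∈ S, ∃ w d, (q, (w, σ, d), q') ∈ M.trans

theorem mem_superposition {c : FreeMonoid α} {q : Q} :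
    q ∈ superposition M c ↔ ∃ b d, M.Reach q (b, c, d) := by
  simp [superposition]

theorem superposition_mul (hM : IsLexTransducer M) {c σ : FreeMonoid α} (hσ : σ.length = 1) :
    superposition M (c * σ) = superpositionStep M (superposition M c) σ := by
  ext q'
  simp only [superpositionStep, Finset.mem_filter, Finset.mem_univ, true_and,
    mem_superposition]
  constructor
  · rintro ⟨b, d, h⟩
    obtain ⟨q₁, b₁, w, d₁, e, h₁, t₁, rfl⟩ := hM.reach_mul hσ h
    exact ⟨q₁, ⟨b₁, d₁, h₁⟩, w, e, t₁⟩
  · rintro ⟨q, ⟨b, d, h⟩, w, e, ht⟩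
    exact ⟨_, _, h.step ht⟩

/-- The automaton over `Σ* × D` that tracks the superposition of `M` and follows only the
transitions of least weight into their target. -/
noncomputable def eraseWeights [LinearOrder W]
    (M : Automaton Q (FreeMonoid W × FreeMonoid α × D)) :
    Automaton (Option (Finset Q × Q)) (FreeMonoid α × D) where
  trans := {t | ∃ S q w σ d q', (q, (w, σ, d), q') ∈ M.trans ∧
    (∀ q₁ ∈ S, ∀ w₁ d₁, (q₁, (w₁, σ, d₁), q') ∈ M.trans → RtlLe w w₁) ∧
    t = (some (S, q), (σ, d), some (superpositionStep M S σ, q'))}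
  trans_fin := by
    refine (((Set.finite_univ (α := Finset Q)).prod M.trans_fin).image fun x =>
      (some (x.1, x.2.1), x.2.2.1.2,
        some (superpositionStep M x.1 x.2.2.1.2.1, x.2.2.2))).subset ?_
    rintro _ ⟨S, q, w, σ, d, q', ht, -, rfl⟩
    exact ⟨(S, (q, (w, σ, d), q')), ⟨Set.mem_univ _, ht⟩, rfl⟩
  init := {x | ∃ q ∈ M.init, x = some (superposition M 1, q)}
  final := {x | ∃ S, ∃ q ∈ M.final, x = some (S, q)}

theorem optimalRun_of_reach_eraseWeights [LinearOrder W] (hM : IsLexTransducer M)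
    (hsf : StronglyFunctional M) {x : Option (Finset Q × Q)} {a : FreeMonoid α × D}
    (h : (eraseWeights M).Reach x a) :
    ∃ q b, x = some (superposition M a.1, q) ∧ OptimalRun M q b a.1 a.2 := by
  induction h with
  | init hx =>
    obtain ⟨q, hq, rfl⟩ := hx
    exact ⟨q, 1, rfl, Reach.init hq, fun b' d' h' => Or.inl (hM.reach_one h').2.symm⟩
  | @step _ _ a _ _ hx ih =>
    obtain ⟨q, b, rfl, hopt⟩ := ih
    obtain ⟨S, q₁, w, σ, d, q', ht, hmin, heq⟩ := hx
    simp only [Prod.mk.injEq, Option.some.injEq] at heq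
    obtain ⟨⟨rfl, rfl⟩, rfl, rfl⟩ := heq
    refine ⟨q', b * w, ?_, (optimalRun_mul_iff hM hsf hopt.1 ht).2 ⟨hopt, ?_⟩⟩
    · rw [Prod.fst_mul, superposition_mul hM (hM.length_input ht)]
    · exact fun q₁ b₁ d₁ w₁ e₁ h₁ => hmin q₁ (mem_superposition.2 ⟨b₁, d₁, h₁⟩) w₁ e₁

theorem reach_eraseWeights_of_optimalRun [LinearOrder W] (hM : IsLexTransducer M)
    (hsf : StronglyFunctional M) {q : Q} {a : FreeMonoid W × FreeMonoid α × D}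
    (h : M.Reach q a) (hopt : OptimalRun M q a.1 a.2.1 a.2.2) :
    (eraseWeights M).Reach (some (superposition M a.2.1, q)) a.2 := by
  induction h with
  | init hq => exact Reach.init ⟨_, hq, rfl⟩
  | @step q q' a x h ht ih =>
    obtain ⟨hopt, hmin⟩ := (optimalRun_mul_iff hM hsf h ht).1 hopt
    refine (ih hopt).step ⟨superposition M a.2.1, q, x.1, x.2.1, x.2.2, q', ht, ?_, ?_⟩
    · intro q₁ hq₁ w₁ e₁ t₁
      obtain ⟨b₁, d₁, h₁⟩ := mem_superposition.1 hq₁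
      exact hmin q₁ b₁ d₁ w₁ e₁ h₁ t₁
    · rw [← superposition_mul hM (hM.length_input ht)]
      rfl

end LexTransducer

/-- **Weights can be erased — strongly functional case.** For every strongly
functional lexicographic transducer `M` over `A = W* × Σ* × D` (one final
state, no reachable conflicting transitions with equal weights) there exists a
finite automaton `N` over `Σ* × D`, with state set a subset of `2^Q × Q`
together with one extra state, whose language equals `min_{D→W*} L(M)\W*`. -/
theorem weights_can_be_erased_stronglyFunctional {Q W α D : Type} [Fintype Q]
    [DecidableEq Q] [Fintype W] [LinearOrder W] [Fintype α] [Monoid D]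
    (M : Automaton Q (FreeMonoid W × FreeMonoid α × D))
    (hM : IsLexTransducer M) (hsf : StronglyFunctional M) :
    ∃ N : Automaton (Option (Finset Q × Q)) (FreeMonoid α × D),
      N.lang = minRel M := by
  obtain ⟨qf, hf⟩ := hsf.1
  refine ⟨eraseWeights M, Set.ext fun ⟨c, d⟩ => ?_⟩
  rw [mem_minRel_iff hM hf, Automaton.mem_lang_iff]
  constructor
  · rintro ⟨_, ⟨S, q, hq, rfl⟩, h⟩
    obtain ⟨q₁, b, heq, hopt⟩ := optimalRun_of_reach_eraseWeights hM hsf h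
    simp only [Option.some.injEq, Prod.mk.injEq] at heq
    obtain ⟨-, rfl⟩ := heq
    rw [hf, Set.mem_singleton_iff] at hq
    subst hq
    exact ⟨b, hopt⟩
  · rintro ⟨b, hopt⟩
    exact ⟨_, ⟨_, qf, hf ▸ rfl, rfl⟩, reach_eraseWeights_of_optimalRun hM hsf hopt.1 hopt⟩
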